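/- Let E be a closed subset of the closed unit disk with at least two points. If E is t-analytic for the disk algebra, then E has no isolated points and for every open arc I of the unit circle disjoint from the closure of E ∩ 𝔻 (the open disk part of E), either I ∩ E is empty or I ∩ E has positive Lebesgue measure on the circle. -/

import Mathlib

open Set Complex

/-- `E` is t-analytic for the algebra `A(K)` of functions continuous on `K` and
holomorphic on the interior of `K`. -/
def TAnalyticOn (K E : Set ℂ) : Prop :=
  ∀ f : ℂ → ℂ, ContinuousOn f K → DifferentiableOn ℂ f (interior K) →
    ∀ U : Set ℂ, IsOpen U → (U ∩ E).Nonempty → (∀ x ∈ U ∩ E, f x = 0) → ∀ x ∈ E, f x = 0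


/-- The building block: positive real part on the closed disc, large near `ζ`. -/
noncomputable def bump (ζ : ℂ) (r : ℝ) (z : ℂ) : ℂ :=
  ((4 * r : ℝ) : ℂ) * (1 + (r : ℂ) - (starRingEnd ℂ) ζ * z)⁻¹

lemma bump_den_re {ζ : ℂ} {r : ℝ} {z : ℂ} (hζ : ‖ζ‖ = 1) (hz : ‖z‖ ≤ 1) :
    r ≤ (1 + (r : ℂ) - (starRingEnd ℂ) ζ * z).re := by
  have h1 : ((starRingEnd ℂ) ζ * z).re ≤ 1 := by
    refine (Complex.re_le_norm _).trans ?_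
    rw [norm_mul, RCLike.norm_conj, hζ, one_mul]
    exact hz
  simp only [Complex.sub_re, Complex.add_re, Complex.one_re, Complex.ofReal_re]
  linarith

lemma bump_aux {ζ z : ℂ} (hζ : ‖ζ‖ = 1) : ‖1 - (starRingEnd ℂ) ζ * z‖ = ‖z - ζ‖ := by
  have h : (starRingEnd ℂ) ζ * ζ = 1 := by
    rw [mul_comm, Complex.mul_conj, Complex.normSq_eq_norm_sq, hζ]; simp
  have : 1 - (starRingEnd ℂ) ζ * z = - ((starRingEnd ℂ) ζ * (z - ζ)) := by
    rw [mul_sub, h]; ring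
  rw [this, norm_neg, norm_mul, RCLike.norm_conj, hζ, one_mul]

lemma bump_den_ne {ζ : ℂ} {r : ℝ} {z : ℂ} (hr : 0 < r) (hζ : ‖ζ‖ = 1) (hz : ‖z‖ ≤ 1) :
    1 + (r : ℂ) - (starRingEnd ℂ) ζ * z ≠ 0 := by
  intro h
  have := bump_den_re (r := r) hζ hz
  rw [h] at this
  simp at this
  linarith

lemma bump_re {ζ : ℂ} {r : ℝ} {z : ℂ} :
    (bump ζ r z).re = 4 * r * ((1 + (r : ℂ) - (starRingEnd ℂ) ζ * z).re /
      ‖1 + (r : ℂ) - (starRingEnd ℂ) ζ * z‖ ^ 2) := by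
  rw [bump, Complex.re_ofReal_mul, Complex.inv_re, Complex.normSq_eq_norm_sq]

lemma bump_re_nonneg {ζ : ℂ} {r : ℝ} {z : ℂ} (hr : 0 < r) (hζ : ‖ζ‖ = 1) (hz : ‖z‖ ≤ 1) :
    0 ≤ (bump ζ r z).re := by
  rw [bump_re]
  have := bump_den_re (r := r) hζ hz
  have h2 : 0 ≤ (1 + (r : ℂ) - (starRingEnd ℂ) ζ * z).re := by linarith
  positivity

lemma bump_re_ge {ζ : ℂ} {r : ℝ} {z : ℂ} (hr : 0 < r) (hζ : ‖ζ‖ = 1) (hz : ‖z‖ ≤ 1)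
    (hd : ‖z - ζ‖ < r) : 1 ≤ (bump ζ r z).re := by
  rw [bump_re]
  have h1 := bump_den_re (r := r) hζ hz
  have h2 := bump_den_ne hr hζ hz
  have h3 : ‖1 + (r : ℂ) - (starRingEnd ℂ) ζ * z‖ ≤ 2 * r := by
    have : 1 + (r : ℂ) - (starRingEnd ℂ) ζ * z = r + (1 - (starRingEnd ℂ) ζ * z) := by ring
    rw [this]
    refine (norm_add_le _ _).trans ?_
    rw [bump_aux hζ, Complex.norm_real, Real.norm_of_nonneg hr.le]
    linarith
  have h4 : 0 < ‖1 + (r : ℂ) - (starRingEnd ℂ) ζ * z‖ := norm_pos_iff.mpr h2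
  rw [← mul_div_assoc, le_div_iff₀ (by positivity)]
  nlinarith

lemma bump_norm_le {ζ : ℂ} {r d : ℝ} {z : ℂ} (hr : 0 < r) (hζ : ‖ζ‖ = 1) (hz : ‖z‖ ≤ 1)
    (hd0 : 0 < d) (hd : d ≤ ‖z - ζ‖) : ‖bump ζ r z‖ ≤ 8 / d * r := by
  have h1 := bump_den_re (r := r) hζ hz
  have h2 := bump_den_ne hr hζ hz
  have h5 := Complex.re_le_norm (1 + (r : ℂ) - (starRingEnd ℂ) ζ * z)
  have h3 : ‖z - ζ‖ - r ≤ ‖1 + (r : ℂ) - (starRingEnd ℂ) ζ * z‖ := by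
    rw [← bump_aux hζ]
    have := norm_sub_le (1 + (r : ℂ) - (starRingEnd ℂ) ζ * z) (r : ℂ)
    rw [show 1 + (r : ℂ) - (starRingEnd ℂ) ζ * z - r = 1 - (starRingEnd ℂ) ζ * z by ring,
      Complex.norm_real, Real.norm_of_nonneg hr.le] at this
    linarith
  have h4 : 0 < ‖1 + (r : ℂ) - (starRingEnd ℂ) ζ * z‖ := norm_pos_iff.mpr h2
  rw [bump, norm_mul, norm_inv, Complex.norm_real, Real.norm_of_nonneg (by positivity),
    ← div_eq_mul_inv, div_le_iff₀ h4]
  have h6 : d / 2 ≤ ‖1 + (r : ℂ) - (starRingEnd ℂ) ζ * z‖ := by linarith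
  calc 4 * r = 8 / d * r * (d / 2) := by field_simp; ring
    _ ≤ _ := by gcongr

lemma bump_diff {ζ : ℂ} {r : ℝ} {z : ℂ} (hr : 0 < r) (hζ : ‖ζ‖ = 1) (hz : ‖z‖ ≤ 1) :
    DifferentiableAt ℂ (bump ζ r) z := by
  unfold bump
  have := bump_den_ne hr hζ hz
  fun_prop (disch := exact this)

/-- Fatou's theorem from a summable family of balls covering `K` infinitely often. -/
lemma fatou_of_cover {ι : Type*} (K : Set ℂ) (hK : IsClosed K) (hK1 : ∀ z ∈ K, ‖z‖ = 1)
    (ζ : ι → ℂ) (r : ι → ℝ) (hζ : ∀ i, ζ i ∈ K) (hr : ∀ i, 0 < r i) (hs : Summable r)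
    (hinf : ∀ k ∈ K, {i | ‖k - ζ i‖ < r i}.Infinite) :
    ∃ f : ℂ → ℂ, ContinuousOn f (Metric.closedBall 0 1) ∧
      DifferentiableOn ℂ f (Metric.ball 0 1) ∧ (∀ z ∈ K, f z = 0) ∧
      ∀ z ∈ Metric.closedBall (0 : ℂ) 1, z ∉ K → f z ≠ 0 := by
  classical
  have hζ1 : ∀ i, ‖ζ i‖ = 1 := fun i => hK1 _ (hζ i)
  set g : ℂ → ℂ := fun z => ∑' i, bump (ζ i) (r i) z with hg
  -- local uniform bound
  have hloc : ∀ z, z ∉ K → ∃ d > 0, ∀ z' ∈ Metric.ball z d, ‖z'‖ ≤ 1 → ∀ i,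
      ‖bump (ζ i) (r i) z'‖ ≤ 8 / d * r i := by
    intro z hz
    obtain ⟨e, he, hb⟩ := Metric.isOpen_iff.mp hK.isOpen_compl z hz
    refine ⟨e / 2, by positivity, fun z' hz' hn i => ?_⟩
    refine bump_norm_le (hr i) (hζ1 i) hn (by positivity) ?_
    have h1 : ¬ dist (ζ i) z < e := fun h => hb (Metric.mem_ball.mpr h) (hζ i)
    have h2 := dist_triangle (ζ i) z' z
    rw [Metric.mem_ball] at hz'
    rw [← dist_eq_norm, dist_comm]
    linarith
  have hsum : ∀ z, z ∉ K → ‖z‖ ≤ 1 → Summable fun i => bump (ζ i) (r i) z := by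
    intro z hz hn
    obtain ⟨d, hd, h⟩ := hloc z hz
    exact Summable.of_norm_bounded (hs.mul_left (8 / d))
      (fun i => h z (Metric.mem_ball_self hd) hn i)
  have hre : ∀ z, z ∉ K → ‖z‖ ≤ 1 → HasSum (fun i => (bump (ζ i) (r i) z).re) (g z).re :=
    fun z hz hn => Complex.hasSum_re (hsum z hz hn).hasSum
  have hre0 : ∀ z, z ∉ K → ‖z‖ ≤ 1 → 0 ≤ (g z).re := fun z hz hn =>
    (hre z hz hn).nonneg (fun i => bump_re_nonneg (hr i) (hζ1 i) hn)
  have hne : ∀ z, z ∉ K → ‖z‖ ≤ 1 → 1 + g z ≠ 0 := by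
    intro z hz hn h
    have h1 := hre0 z hz hn
    have h2 := congrArg Complex.re h
    simp at h2
    linarith
  set f : ℂ → ℂ := fun z => if z ∈ K then 0 else (1 + g z)⁻¹ with hf
  have hfg : ∀ z, z ∉ K → f =ᶠ[nhds z] fun z => (1 + g z)⁻¹ := by
    intro z hz
    filter_upwards [hK.isOpen_compl.mem_nhds hz] with w hw
    exact if_neg hw
  refine ⟨f, ?_, ?_, ?_, ?_⟩
  · intro z hz
    have hzn : ‖z‖ ≤ 1 := by simpa using hz
    by_cases hzK : z ∈ K
    · have hfz : f z = 0 := if_pos hzK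
      rw [ContinuousWithinAt, hfz, Metric.tendsto_nhds]
      intro ε hε
      obtain ⟨N, hN⟩ := exists_nat_gt (1 / ε)
      obtain ⟨F, hF, hFc⟩ := (hinf z hzK).exists_subset_card_eq N
      have hev : ∀ᶠ w in nhds z, ∀ i ∈ F, ‖w - ζ i‖ < r i := by
        rw [Filter.eventually_all_finset]
        intro i hi
        have hc : Continuous fun w : ℂ => ‖w - ζ i‖ := by fun_prop
        exact hc.continuousAt.eventually_lt continuousAt_const (hF hi)
      filter_upwards [mem_nhdsWithin_of_mem_nhds hev, self_mem_nhdsWithin] with w hw hw1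
      have hwn : ‖w‖ ≤ 1 := by simpa using hw1
      rw [dist_zero_right]
      by_cases hwK : w ∈ K
      · simp only [hf, if_pos hwK, norm_zero]; exact hε
      · simp only [hf, if_neg hwK]
        have h1 : (N : ℝ) ≤ (g w).re := by
          refine le_trans ?_ (sum_le_hasSum F
            (fun i _ => bump_re_nonneg (hr i) (hζ1 i) hwn) (hre w hwK hwn))
          calc (N : ℝ) = ∑ i ∈ F, (1 : ℝ) := by simp [hFc]
            _ ≤ _ := Finset.sum_le_sum
              fun i hi => bump_re_ge (hr i) (hζ1 i) hwn (hw i hi)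
        have h2 : (1 + g w).re ≤ ‖1 + g w‖ := Complex.re_le_norm _
        simp only [Complex.add_re, Complex.one_re] at h2
        have h3 : 1 / ε < ‖1 + g w‖ := by linarith
        rw [norm_inv]
        exact inv_lt_of_inv_lt₀ hε (by rwa [one_div] at h3)
    · refine ContinuousWithinAt.congr_of_eventuallyEq ?_
        (mem_nhdsWithin_of_mem_nhds (hfg z hzK)) (hfg z hzK).eq_of_nhds
      refine ContinuousWithinAt.inv₀ ?_ (hne z hzK hzn)
      refine continuousWithinAt_const.add ?_
      obtain ⟨d, hd, h⟩ := hloc z hzK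
      have hc : ContinuousOn g (Metric.closedBall 0 1 ∩ Metric.ball z d) := by
        refine continuousOn_tsum (fun i w hw => ?_) (hs.mul_left (8 / d))
          (fun i w hw => h w hw.2 (by simpa using hw.1) i)
        exact (bump_diff (hr i) (hζ1 i) (by simpa using hw.1)).continuousAt.continuousWithinAt
      exact (continuousWithinAt_inter (Metric.ball_mem_nhds z hd)).mp
        (hc z ⟨hz, Metric.mem_ball_self hd⟩)
  · intro z hz
    have hzn : ‖z‖ < 1 := by simpa using hz
    have hzK : z ∉ K := fun h => by have := hK1 z h; linarith
    refine DifferentiableAt.differentiableWithinAt ?_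
    refine ((hfg z hzK).differentiableAt_iff).mpr ?_
    obtain ⟨d, hd, h⟩ := hloc z hzK
    have ho : IsOpen (Metric.ball (0:ℂ) 1 ∩ Metric.ball z d) :=
      Metric.isOpen_ball.inter Metric.isOpen_ball
    have hn : ∀ w ∈ Metric.ball (0:ℂ) 1 ∩ Metric.ball z d, ‖w‖ ≤ 1 := by
      intro w hw
      have : ‖w‖ < 1 := by simpa using hw.1
      exact this.le
    have hc : DifferentiableOn ℂ g (Metric.ball 0 1 ∩ Metric.ball z d) :=
      Complex.differentiableOn_tsum_of_summable_norm (hs.mul_left (8 / d))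
        (fun i w hw => (bump_diff (hr i) (hζ1 i) (hn w hw)).differentiableWithinAt) ho
        (fun i w hw => h w hw.2 (hn w hw) i)
    have hga : DifferentiableAt ℂ g z :=
      hc.differentiableAt (ho.mem_nhds ⟨hz, Metric.mem_ball_self hd⟩)
    exact ((differentiableAt_const _).add hga).inv (hne z hzK hzn.le)
  · intro z hz
    exact if_pos hz
  · intro z hz hzK
    simp only [hf, if_neg hzK]
    exact inv_ne_zero (hne z hzK (by simpa using hz))

lemma norm_exp_sub_exp_le (s t : ℝ) :
    ‖Complex.exp (s * Complex.I) - Complex.exp (t * Complex.I)‖ ≤ |s - t| := by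
  have h : Complex.exp (s * Complex.I) - Complex.exp (t * Complex.I) =
      Complex.exp (t * Complex.I) * (Complex.exp (Complex.I * ((s - t : ℝ) : ℂ)) - 1) := by
    rw [mul_sub, ← Complex.exp_add, mul_one]
    congr 2
    push_cast
    ring
  rw [h, norm_mul, Complex.norm_exp_ofReal_mul_I, one_mul, ← Real.norm_eq_abs]
  exact Real.norm_exp_I_mul_ofReal_sub_one_le

lemma fatou_circle (S : Set ℝ) (hS : IsCompact S) (h0 : MeasureTheory.volume S = 0) :
    ∃ f : ℂ → ℂ, ContinuousOn f (Metric.closedBall 0 1) ∧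
      DifferentiableOn ℂ f (Metric.ball 0 1) ∧
      (∀ θ ∈ S, f (Complex.exp ((θ : ℝ) * Complex.I)) = 0) ∧
      ∀ z ∈ Metric.closedBall (0 : ℂ) 1,
        z ∉ (fun θ : ℝ => Complex.exp (θ * Complex.I)) '' S → f z ≠ 0 := by
  have hcov : ∀ n : ℕ, ∃ (t : Set ℝ) (r : ℝ → ℝ), t ⊆ S ∧ (∀ x ∈ t, 0 < r x) ∧
      (S ⊆ ⋃ x ∈ t, Metric.closedBall x (r x)) ∧
      (∑' x : t, MeasureTheory.volume (Metric.closedBall (x : ℝ) (r x))) ≤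
        (2⁻¹ : ENNReal) ^ n := by
    intro n
    obtain ⟨t, r, -, h1, h2, h3, h4⟩ := Besicovitch.exists_closedBall_covering_tsum_measure_le
      (MeasureTheory.volume : MeasureTheory.Measure ℝ) (ε := (2⁻¹ : ENNReal) ^ n)
      (by simp) (fun _ => Ioi 0) S
      (fun x _ δ hδ => ⟨δ / 2, by simpa using hδ, by simpa using hδ, by linarith⟩)
    exact ⟨t, r, h1, h2, h3, by simpa [h0] using h4⟩
  choose t r ht hr hc hm using hcov
  have hpos : ∀ i : (Σ n, t n), 0 < r i.1 i.2 := fun i => hr i.1 i.2 i.2.2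
  have hsum : Summable fun i : (Σ n, t n) => 2 * r i.1 i.2 := by
    have h1 : (∑' i : (Σ n, t n),
        MeasureTheory.volume (Metric.closedBall (i.2 : ℝ) (r i.1 i.2))) ≠ ⊤ := by
      rw [ENNReal.tsum_sigma']
      refine ne_top_of_le_ne_top ?_ (ENNReal.tsum_le_tsum hm)
      rw [ENNReal.tsum_geometric]
      simp
    refine (ENNReal.summable_toReal h1).congr (fun i => ?_)
    rw [Real.volume_closedBall, ENNReal.toReal_ofReal]
    linarith [hpos i]
  have hcont : Continuous fun θ : ℝ => Complex.exp (θ * Complex.I) := by fun_prop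
  obtain ⟨f, hf1, hf2, hf3, hf4⟩ := fatou_of_cover
    ((fun θ : ℝ => Complex.exp (θ * Complex.I)) '' S) (hS.image hcont).isClosed
    (by rintro _ ⟨θ, -, rfl⟩; exact Complex.norm_exp_ofReal_mul_I θ)
    (fun i : (Σ n, t n) => Complex.exp (((i.2 : ℝ) : ℂ) * Complex.I))
    (fun i => 2 * r i.1 i.2)
    (fun i => ⟨i.2, ht _ i.2.2, rfl⟩) (fun i => by linarith [hpos i]) hsum
    (by
      rintro _ ⟨θ, hθ, rfl⟩
      have hx : ∀ n, ∃ x : t n, |θ - x| ≤ r n x := by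
        intro n
        obtain ⟨x, hx, hd⟩ := mem_iUnion₂.mp (hc n hθ)
        exact ⟨⟨x, hx⟩, by simpa [Real.dist_eq] using hd⟩
      choose x hx using hx
      refine Set.infinite_of_injective_forall_mem (f := fun n : ℕ => (⟨n, x n⟩ : Σ n, t n))
        (fun a b hab => congrArg Sigma.fst hab) (fun n => ?_)
      have h1 := norm_exp_sub_exp_le θ (x n)
      have h2 := hx n
      have h3 := hpos ⟨n, x n⟩
      simp only [mem_ofPred_eq] at h3 ⊢
      linarith)
  exact ⟨f, hf1, hf2, fun θ hθ => hf3 _ ⟨θ, hθ, rfl⟩, hf4⟩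

theorem tAnalytic_diskAlgebra_necessary (E : Set ℂ)
    (hE : E ⊆ Metric.closedBall 0 1) (hclosed : IsClosed E)
    (htwo : ∃ a ∈ E, ∃ b ∈ E, a ≠ b)
    (ht : TAnalyticOn (Metric.closedBall 0 1) E) :
    (∀ x ∈ E, x ∈ closure (E \ {x})) ∧
    ∀ a b : ℝ, a < b →
      ((fun θ : ℝ => Complex.exp (θ * Complex.I)) '' Ioo a b) ∩
          closure (E ∩ Metric.ball 0 1) = ∅ →
      ((fun θ : ℝ => Complex.exp (θ * Complex.I)) '' Ioo a b) ∩ E = ∅ ∨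
        0 < MeasureTheory.volume {θ ∈ Ioo a b | Complex.exp (θ * Complex.I) ∈ E} := by
  have hint : interior (Metric.closedBall (0 : ℂ) 1) = Metric.ball 0 1 :=
    interior_closedBall _ one_ne_zero
  constructor
  · intro x hx
    by_contra hcl
    have h := ht (fun z => z - x) (by fun_prop) (by fun_prop) (closure (E \ {x}))ᶜ
      isClosed_closure.isOpen_compl ⟨x, hcl, hx⟩ (by
        rintro y ⟨hy, hyE⟩
        by_contra hne
        exact hy (subset_closure ⟨hyE, fun h => hne (sub_eq_zero.mpr h)⟩))
    obtain ⟨a, ha, b, hb, hab⟩ := htwo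
    exact hab ((sub_eq_zero.mp (h a ha)).trans (sub_eq_zero.mp (h b hb)).symm)
  · intro a b hab hdisj
    by_contra hcon
    push Not at hcon
    obtain ⟨hne, hvol⟩ := hcon
    have hvol0 : MeasureTheory.volume {θ ∈ Ioo a b | Complex.exp (θ * Complex.I) ∈ E} = 0 := by
      simpa using hvol
    obtain ⟨_, ⟨θ₀, hθ₀, rfl⟩, hpE⟩ := hne
    simp only at hpE
    set p := Complex.exp (θ₀ * Complex.I) with hp
    have hcont : Continuous fun θ : ℝ => Complex.exp (θ * Complex.I) := by fun_prop
    obtain ⟨q, hqE, hqp⟩ : ∃ q ∈ E, q ≠ p := by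
      obtain ⟨x, hx, y, hy, hxy⟩ := htwo
      by_cases h : x = p
      · exact ⟨y, hy, fun h' => hxy (h.trans h'.symm)⟩
      · exact ⟨x, hx, h⟩
    have hev : ∀ᶠ θ in nhds θ₀, θ ∈ Ioo a b ∧ Complex.exp ((θ : ℝ) * Complex.I) ≠ q :=
      (isOpen_Ioo.eventually_mem hθ₀).and (hcont.continuousAt.eventually_ne hqp.symm)
    obtain ⟨δ, hδ, hball⟩ := Metric.nhds_basis_closedBall.eventually_iff.mp hev
    set S : Set ℝ := Metric.closedBall θ₀ δ ∩
      (fun θ : ℝ => Complex.exp (θ * Complex.I)) ⁻¹' E with hSdef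
    have hS : IsCompact S :=
      (isCompact_closedBall θ₀ δ).inter_right (hclosed.preimage hcont)
    have hS0 : MeasureTheory.volume S = 0 :=
      MeasureTheory.measure_mono_null
        (show S ⊆ {θ ∈ Ioo a b | Complex.exp (θ * Complex.I) ∈ E} from
          fun θ hθ => ⟨(hball hθ.1).1, hθ.2⟩) hvol0
    obtain ⟨f, hf1, hf2, hf3, hf4⟩ := fatou_circle S hS hS0
    have hp0 : p ≠ 0 := Complex.exp_ne_zero _
    have harg : ∀ᶠ z in nhds p, |Complex.arg (z / p)| < δ := by
      have h1 : ContinuousAt (fun z : ℂ => Complex.arg (z / p)) p := by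
        refine ContinuousAt.comp (g := Complex.arg) ?_ (by fun_prop)
        rw [div_self hp0]
        exact Complex.continuousAt_arg Complex.one_mem_slitPlane
      have h2 : ContinuousAt (fun z : ℂ => |Complex.arg (z / p)|) p := h1.abs
      refine h2.eventually_lt continuousAt_const ?_
      simpa [div_self hp0] using hδ
    have hpcl : p ∉ closure (E ∩ Metric.ball 0 1) := fun h => by
      have : p ∈ (∅ : Set ℂ) := hdisj ▸ ⟨⟨θ₀, hθ₀, rfl⟩, h⟩
      exact this
    obtain ⟨V, hV, hVo, hpV⟩ := eventually_nhds_iff.mp harg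
    have hfq := ht f hf1 (by rw [hint]; exact hf2) (V ∩ (closure (E ∩ Metric.ball 0 1))ᶜ)
      (hVo.inter isClosed_closure.isOpen_compl) ⟨p, ⟨hpV, hpcl⟩, hpE⟩ (by
        rintro z ⟨⟨hzV, hzc⟩, hzE⟩
        have hz1 : ‖z‖ = 1 := by
          have h1 : ‖z‖ ≤ 1 := by simpa using hE hzE
          refine le_antisymm h1 (not_lt.mp fun h => hzc (subset_closure ⟨hzE, ?_⟩))
          simpa using h
        have hzp : ‖z / p‖ = 1 := by
          rw [norm_div, hz1, hp, Complex.norm_exp_ofReal_mul_I, div_one]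
        have hz : Complex.exp ((θ₀ + Complex.arg (z / p) : ℝ) * Complex.I) = z := by
          have h1 := Complex.norm_mul_exp_arg_mul_I (z / p)
          rw [hzp, Complex.ofReal_one, one_mul] at h1
          rw [Complex.ofReal_add, add_mul, Complex.exp_add, h1, ← hp, mul_div_cancel₀ _ hp0]
        rw [← hz]
        refine hf3 _ ⟨?_, ?_⟩
        · rw [Metric.mem_closedBall, Real.dist_eq, add_sub_cancel_left]
          exact (hV z hzV).le
        · rw [mem_preimage, hz]; exact hzE) q hqE
    refine hf4 q (hE hqE) ?_ hfq
    rintro ⟨θ, hθ, h⟩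
    exact (hball hθ.1).2 h
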